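/- There is no cellular automaton f on {0,1}^ℤ whose generic limit set equals the orbit closure of the configuration …000111… , i.e., the subshift X = {x ∈ {0,1}^ℤ : x_i ≤ x_{i+1} for all i ∈ ℤ}. -/

import Mathlib

open Filter Set Function

namespace Gls

variable {A : Type*}

/-- The left shift map on `A^ℤ`. -/
def shift (x : ℤ → A) : ℤ → A := fun i => x (i + 1)

/-- A cellular automaton: a continuous shift-commuting self-map of the full shift. -/
def IsCA [TopologicalSpace A] (f : (ℤ → A) → (ℤ → A)) : Prop :=
  Continuous f ∧ f ∘ shift = shift ∘ f

/-- The set of limit points of the forward orbit of `x` under `f`. -/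
def omegaSet [TopologicalSpace A] (f : (ℤ → A) → (ℤ → A)) (x : ℤ → A) : Set (ℤ → A) :=
  {y | MapClusterPt y atTop fun t => f^[t] x}

/-- The realm of attraction of `Y`. -/
def realm [TopologicalSpace A] (f : (ℤ → A) → (ℤ → A)) (Y : Set (ℤ → A)) : Set (ℤ → A) :=
  {x | omegaSet f x ⊆ Y}

/-- The generic limit set: the intersection of all closed sets whose realm is comeager. -/
def genLimitSet [TopologicalSpace A] (f : (ℤ → A) → (ℤ → A)) : Set (ℤ → A) :=
  ⋂₀ {C | IsClosed C ∧ realm f C ∈ residual (ℤ → A)}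

/-- The word `x_{[i, i+n)}` of length `n` read in the configuration `x` from position `i`. -/
def word (x : ℤ → A) (i : ℤ) (n : ℕ) : List A :=
  (List.range n).map fun k => x (i + k)

/-- The cylinder set `[w]_i`. -/
def cylinder (w : List A) (i : ℤ) : Set (ℤ → A) := {x | word x i w.length = w}

/-- The language of `X`: all finite words occurring in points of `X`. -/
def lang (X : Set (ℤ → A)) : Set (List A) :=
  {w | ∃ x ∈ X, ∃ i : ℤ, word x i w.length = w}


def sh (j : ℤ) (x : ℤ → Fin 2) : ℤ → Fin 2 := fun i => x (i + j)

def SX : Set (ℤ → Fin 2) := {x : ℤ → Fin 2 | ∀ i : ℤ, x i ≤ x (i + 1)}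

def stp (p : ℤ) : ℤ → Fin 2 := fun i => if p ≤ i then 1 else 0

lemma SX_mono {x : ℤ → Fin 2} (hx : x ∈ SX) : Monotone x := monotone_int_of_le_succ hx

lemma SX_closed : IsClosed SX := by
  have : SX = ⋂ i : ℤ, {x : ℤ → Fin 2 | x i ≤ x (i + 1)} := by
    ext x; simp [SX]
  rw [this]
  exact isClosed_iInter fun i => isClosed_le (continuous_apply i) (continuous_apply (i + 1))

lemma stp_mem (p : ℤ) : stp p ∈ SX := by
  intro i
  unfold stp
  split_ifs <;> omega

lemma sh_comm {f : (ℤ → Fin 2) → (ℤ → Fin 2)} (hf : f ∘ shift = shift ∘ f) (j : ℤ)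
    (x : ℤ → Fin 2) : f (sh j x) = sh j (f x) := by
  have h1 : ∀ y, f (sh 1 y) = sh 1 (f y) := fun y => congrFun hf y
  have hadd : ∀ a b : ℤ, ∀ y, sh a (sh b y) = sh (a + b) y := by
    intro a b y; funext i; simp [sh, add_assoc]
  have h0 : ∀ y, sh 0 y = y := by intro y; funext i; simp [sh]
  induction j using Int.induction_on with
  | zero => simp [h0]
  | succ n ih => rw [add_comm, ← hadd, h1, ih, hadd]
  | pred n ih =>
    have h2 := h1 (sh (-(n:ℤ) - 1) x)
    rw [hadd, show (1 + (-(n:ℤ) - 1)) = -n by ring, ih] at h2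
    have h3 := congrArg (sh (-1)) h2
    rw [hadd, hadd, show (-1 + (1:ℤ)) = 0 by ring, h0] at h3
    rw [← h3]; congr 1; ring

lemma SX_cases {s : ℤ → Fin 2} (hs : s ∈ SX) :
    s = (fun _ => 0) ∨ s = (fun _ => 1) ∨ ∃ p, s = stp p := by
  by_cases h0 : ∃ b, s b = 0
  swap
  · right; left; funext i
    have : s i ≠ 0 := fun h => h0 ⟨i, h⟩
    omega
  by_cases h1 : ∃ a, s a = 1
  swap
  · left; funext i
    have : s i ≠ 1 := fun h => h1 ⟨i, h⟩
    omega
  right; right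
  obtain ⟨b, hb⟩ := h0
  have hm := SX_mono hs
  obtain ⟨p, hp, hp'⟩ := Int.exists_least_of_bdd (P := fun a => s a = 1) ⟨b, fun z hz => by
    by_contra hlt
    have := hm (le_of_lt (not_le.mp hlt))
    rw [hz, hb] at this
    exact absurd this (by decide)⟩ h1
  refine ⟨p, ?_⟩
  funext i
  unfold stp
  split_ifs with h
  · have := hm h
    rw [hp] at this
    omega
  · have : s i ≠ 1 := fun h' => h (hp' i h')
    omega

lemma SX_total {a b : ℤ → Fin 2} (ha : a ∈ SX) (hb : b ∈ SX) : a ≤ b ∨ b ≤ a := by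
  by_cases h : a ≤ b
  · exact Or.inl h
  right
  rw [Pi.le_def] at h
  push Not at h
  obtain ⟨i, hi⟩ := h
  intro j
  rcases le_total j i with hj | hj
  · have := SX_mono hb hj
    rw [Fin.le_def] at *
    omega
  · have := SX_mono ha hj
    rw [Fin.le_def] at *
    omega

lemma tend0 : Tendsto (fun n : ℕ => stp (n : ℤ)) atTop (nhds (fun _ => 0)) := by
  rw [tendsto_pi_nhds]
  intro i
  apply tendsto_const_nhds.congr'
  filter_upwards [eventually_gt_atTop i.toNat] with n hn
  simp only [stp]
  rw [if_neg (by omega)]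

lemma tend1 : Tendsto (fun n : ℕ => stp (-(n : ℤ))) atTop (nhds (fun _ => 1)) := by
  rw [tendsto_pi_nhds]
  intro i
  apply tendsto_const_nhds.congr'
  filter_upwards [eventually_gt_atTop (-i).toNat] with n hn
  simp only [stp]
  rw [if_pos (by omega)]

lemma dich {f : (ℤ → Fin 2) → (ℤ → Fin 2)} (hf : IsCA f) (hS : ∀ s ∈ SX, f s ∈ SX) :
    (∀ s ∈ SX, f s ≤ s) ∨ (∀ s ∈ SX, s ≤ f s) := by
  have hsh : ∀ p, stp p = sh (-p) (stp 0) := by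
    intro p; funext i; simp [stp, sh]
  rcases SX_total (hS _ (stp_mem 0)) (stp_mem 0) with h | h
  · left
    have hp : ∀ p, f (stp p) ≤ stp p := by
      intro p; rw [hsh, sh_comm hf.2]; intro i; exact h _
    intro s hs
    rcases SX_cases hs with rfl | rfl | ⟨p, rfl⟩
    · exact le_of_tendsto_of_tendsto' ((hf.1.tendsto _).comp tend0) tend0 (fun n => hp _)
    · intro i; exact Fin.le_last _
    · exact hp p
  · right
    have hp : ∀ p, stp p ≤ f (stp p) := by
      intro p; rw [hsh, sh_comm hf.2]; intro i; exact h _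
    intro s hs
    rcases SX_cases hs with rfl | rfl | ⟨p, rfl⟩
    · intro i; exact Fin.zero_le _
    · exact le_of_tendsto_of_tendsto' tend1 ((hf.1.tendsto _).comp tend1) (fun n => hp _)
    · exact hp p

lemma omega_map {f : (ℤ → Fin 2) → (ℤ → Fin 2)} (hf : Continuous f) {x y : ℤ → Fin 2}
    (hy : y ∈ omegaSet f x) : f y ∈ omegaSet f x := by
  have h1 : MapClusterPt (f y) atTop (fun t => f (f^[t] x)) :=
    MapClusterPt.continuousAt_comp hf.continuousAt hy
  have h2 : (fun t => f (f^[t] x)) = (fun t => f^[t] x) ∘ (fun t => t + 1) := by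
    funext t; simp [Function.iterate_succ_apply']
  rw [h2] at h1
  exact MapClusterPt.of_comp (tendsto_add_atTop_nat 1) h1

lemma gls_map {f : (ℤ → Fin 2) → (ℤ → Fin 2)} (hf : Continuous f) {s : ℤ → Fin 2}
    (hs : s ∈ genLimitSet f) : f s ∈ genLimitSet f := by
  rintro C ⟨hC, hr⟩
  refine hs (f ⁻¹' C) ⟨hC.preimage hf, mem_of_superset hr ?_⟩
  intro x hx y hy
  exact hx (omega_map hf hy)

lemma gls_realm (f : (ℤ → Fin 2) → (ℤ → Fin 2)) :
    realm f (genLimitSet f) ∈ residual (ℤ → Fin 2) := by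
  obtain ⟨T, hTc, hTs, hTU⟩ := TopologicalSpace.isOpen_sUnion_countable
    (compl '' {C | IsClosed C ∧ realm f C ∈ residual (ℤ → Fin 2)})
    (by rintro _ ⟨C, hC, rfl⟩; exact hC.1.isOpen_compl)
  have : (⋂ U ∈ T, realm f Uᶜ) ∈ residual (ℤ → Fin 2) := by
    rw [countable_bInter_mem hTc]
    intro U hU
    obtain ⟨C, hC, rfl⟩ := hTs hU
    rw [compl_compl]; exact hC.2
  refine mem_of_superset this ?_
  intro x hx y hy C hC
  by_contra hyC
  have : y ∈ ⋃₀ T := by rw [hTU]; exact ⟨Cᶜ, ⟨C, hC, rfl⟩, hyC⟩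
  obtain ⟨U, hU, hyU⟩ := this
  exact (mem_iInter₂.mp hx U hU) hy hyU

lemma ev_const {u : ℕ → Fin 2}
    (h : (∀ᶠ t in atTop, u (t + 1) ≤ u t) ∨ (∀ᶠ t in atTop, u t ≤ u (t + 1))) :
    ∃ c, ∀ᶠ t in atTop, u t = c := by
  rcases h with h | h
  · obtain ⟨N, hN⟩ := eventually_atTop.mp h
    by_cases h0 : ∃ t ≥ N, u t = 0
    · obtain ⟨t, ht, h0⟩ := h0
      refine ⟨0, eventually_atTop.mpr ⟨t, fun s hs => ?_⟩⟩
      induction s, hs using Nat.le_induction with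
      | base => exact h0
      | succ s hs ih => have := hN s (by omega); omega
    · refine ⟨1, eventually_atTop.mpr ⟨N, fun s hs => ?_⟩⟩
      have : u s ≠ 0 := fun h => h0 ⟨s, hs, h⟩
      omega
  · obtain ⟨N, hN⟩ := eventually_atTop.mp h
    by_cases h0 : ∃ t ≥ N, u t = 1
    · obtain ⟨t, ht, h0⟩ := h0
      refine ⟨1, eventually_atTop.mpr ⟨t, fun s hs => ?_⟩⟩
      induction s, hs using Nat.le_induction with
      | base => exact h0
      | succ s hs ih => have := hN s (by omega); omega
    · refine ⟨0, eventually_atTop.mpr ⟨N, fun s hs => ?_⟩⟩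
      have : u s ≠ 1 := fun h => h0 ⟨s, hs, h⟩
      omega

/-- if the omega set lies in an open set then the orbit is eventually in it -/
lemma ev_of_omega {f : (ℤ → Fin 2) → (ℤ → Fin 2)} {x : ℤ → Fin 2} {U : Set (ℤ → Fin 2)}
    (hU : IsOpen U) (h : omegaSet f x ⊆ U) : ∀ᶠ t in atTop, f^[t] x ∈ U := by
  by_contra hne
  rw [not_eventually] at hne
  obtain ⟨y, hy, hy'⟩ := (hU.isClosed_compl.isCompact).exists_mapClusterPt_of_frequently hne
  exact hy (h hy')

lemma ev_coord {f : (ℤ → Fin 2) → (ℤ → Fin 2)} (hf : IsCA f) (hS : ∀ s ∈ SX, f s ∈ SX)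
    {x : ℤ → Fin 2} (hx : x ∈ realm f SX) (m : ℤ) :
    ∃ c, ∀ᶠ t in atTop, f^[t] x m = c := by
  have hc : Continuous (fun z : ℤ → Fin 2 => ((f z m, z m) : Fin 2 × Fin 2)) :=
    ((continuous_apply m).comp hf.1).prodMk (continuous_apply m)
  apply ev_const
  rcases dich hf hS with h | h
  · left
    have := ev_of_omega (f := f) (x := x) (U := {z | f z m ≤ z m})
      ((isOpen_discrete {p : Fin 2 × Fin 2 | p.1 ≤ p.2}).preimage hc)
      (fun s hs => h s (hx hs) m)
    simpa only [Function.iterate_succ_apply', Set.mem_ofPred_eq] using this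
  · right
    have := ev_of_omega (f := f) (x := x) (U := {z | z m ≤ f z m})
      ((isOpen_discrete {p : Fin 2 × Fin 2 | p.2 ≤ p.1}).preimage hc)
      (fun s hs => h s (hx hs) m)
    simpa only [Function.iterate_succ_apply', Set.mem_ofPred_eq] using this

def FT (f : (ℤ → Fin 2) → (ℤ → Fin 2)) (T : ℕ) : Set (ℤ → Fin 2) :=
  {x | ∀ t ≥ T, f^[t] x (-1) = 0 ∧ f^[t] x 0 = 1}

lemma cyl_clopen : IsClopen {x : ℤ → Fin 2 | x (-1) = 0 ∧ x 0 = 1} := by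
  have hc : Continuous (fun z : ℤ → Fin 2 => ((z (-1), z 0) : Fin 2 × Fin 2)) :=
    (continuous_apply _).prodMk (continuous_apply _)
  have := (isClopen_discrete {p : Fin 2 × Fin 2 | p.1 = 0 ∧ p.2 = 1}).preimage hc
  exact this

lemma FT_closed {f : (ℤ → Fin 2) → (ℤ → Fin 2)} (hf : Continuous f) (T : ℕ) :
    IsClosed (FT f T) := by
  have : FT f T = ⋂ t : ℕ, ⋂ _ : t ≥ T, f^[t] ⁻¹' {x : ℤ → Fin 2 | x (-1) = 0 ∧ x 0 = 1} := by
    ext x; simp [FT]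
  rw [this]
  exact isClosed_iInter fun t => isClosed_iInter fun _ => cyl_clopen.1.preimage (hf.iterate t)

/-- the shift is mixing enough -/
lemma mix {U : Set (ℤ → Fin 2)} (hU : IsOpen U) {x : ℤ → Fin 2} (hx : x ∈ U) :
    ∃ j : ℤ, 2 ≤ j ∧ ∃ z ∈ U, sh j z ∈ U := by
  obtain ⟨I, u, hu, hsub⟩ := isOpen_pi_iff.mp hU x hx
  obtain ⟨n, hn⟩ : ∃ n : ℕ, ∀ i ∈ I, i.natAbs ≤ n :=
    ⟨I.sup Int.natAbs, fun i hi => Finset.le_sup (f := Int.natAbs) hi⟩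
  refine ⟨2 * n + 2, by omega, fun i => if i ≤ n then x i else x (i - (2 * n + 2)), ?_, ?_⟩
  · apply hsub
    intro i hi
    have := hn i hi
    simp only
    rw [if_pos (by omega)]
    exact (hu i hi).2
  · apply hsub
    intro i hi
    have := hn i hi
    simp only [sh]
    rw [if_neg (by omega), add_sub_cancel_right]
    exact (hu i hi).2

/-- no cellular automaton on `{0,1}^ℤ` has as its generic limit set the
orbit closure of `…000111…`, i.e. the subshift `{x : x_i ≤ x_{i+1} for all i}`. -/
theorem stmt13 :
    ¬ ∃ f : (ℤ → Fin 2) → (ℤ → Fin 2), IsCA f ∧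
      genLimitSet f = {x : ℤ → Fin 2 | ∀ i : ℤ, x i ≤ x (i + 1)} := by
  rintro ⟨f, hf, hG⟩
  change genLimitSet f = SX at hG
  have hS : ∀ s ∈ SX, f s ∈ SX := by
    intro s hs; rw [← hG] at hs ⊢; exact gls_map hf.1 hs
  have hR : realm f SX ∈ residual (ℤ → Fin 2) := by
    have := gls_realm f
    rwa [hG] at this
  have key : ∃ T, (interior (FT f T)).Nonempty := by
    by_contra hno
    push Not at hno
    have h1 : (⋂ T, (FT f T)ᶜ) ∈ residual (ℤ → Fin 2) := by
      rw [countable_iInter_mem]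
      intro T
      apply residual_of_dense_open (FT_closed hf.1 T).isOpen_compl
      rw [← interior_eq_empty_iff_dense_compl]
      exact hno T
    have h2 : stp 0 ∈ SX \ {x : ℤ → Fin 2 | x (-1) = 0 ∧ x 0 = 1} := by
      have h3 : stp 0 ∈ genLimitSet f := by rw [hG]; exact stp_mem 0
      refine h3 _ ⟨SX_closed.sdiff cyl_clopen.2, ?_⟩
      filter_upwards [h1, hR] with x hx hxR
      intro s hs
      refine ⟨hxR hs, fun hs' => ?_⟩
      have hfr : ∃ᶠ t in atTop, f^[t] x ∈ {x : ℤ → Fin 2 | x (-1) = 0 ∧ x 0 = 1} :=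
        MapClusterPt.frequently hs (cyl_clopen.2.mem_nhds hs')
      obtain ⟨a, ha⟩ := ev_coord hf hS hxR (-1)
      obtain ⟨b, hb⟩ := ev_coord hf hS hxR 0
      obtain ⟨t, ⟨ht1, ht2⟩, ht3, ht4⟩ := (hfr.and_eventually (ha.and hb)).exists
      obtain ⟨T, hT⟩ := eventually_atTop.mp (ha.and hb)
      refine mem_iInter.mp hx T fun t' ht' => ?_
      obtain ⟨q1, q2⟩ := hT t' ht'
      exact ⟨by rw [q1, ← ht3, ht1], by rw [q2, ← ht4, ht2]⟩
    exact h2.2 (by simp [stp])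
  obtain ⟨T, x, hx⟩ := key
  obtain ⟨j, hj, z, hz, hz'⟩ := mix isOpen_interior hx
  have hshc : Continuous (sh j) := continuous_pi fun i => continuous_apply (i + j)
  have hV : IsOpen (interior (FT f T) ∩ sh j ⁻¹' interior (FT f T)) :=
    isOpen_interior.inter (isOpen_interior.preimage hshc)
  obtain ⟨w, ⟨hw1, hw2⟩, hwR⟩ := (dense_of_mem_residual hR).inter_open_nonempty _ hV ⟨z, hz, hz'⟩
  have hw1 := interior_subset hw1
  have hw2 : sh j w ∈ FT f T := interior_subset hw2
  have hit : ∀ t, f^[t] (sh j w) = sh j (f^[t] w) := by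
    intro t
    induction t with
    | zero => rfl
    | succ t ih => rw [Function.iterate_succ_apply', ih, sh_comm hf.2, Function.iterate_succ_apply']
  have hc : Continuous (fun z : ℤ → Fin 2 => ((z 0, z (j - 1)) : Fin 2 × Fin 2)) :=
    (continuous_apply _).prodMk (continuous_apply _)
  have hev := ev_of_omega (f := f) (x := w) (U := {z | z 0 ≤ z (j - 1)})
      ((isOpen_discrete {p : Fin 2 × Fin 2 | p.1 ≤ p.2}).preimage hc)
      (fun s hs => SX_mono (hwR hs) (by omega))
  obtain ⟨t, ht, htT⟩ := (hev.and (eventually_ge_atTop T)).exists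
  have e1 := (hw1 t htT).2
  have e2 := (hw2 t htT).1
  rw [hit] at e2
  simp only [sh] at e2
  rw [show (-1 + j) = j - 1 by ring] at e2
  simp only [mem_ofPred_eq] at ht
  rw [e1, e2] at ht
  exact absurd ht (by decide)

end Gls
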